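/- Character evaluation at z = iq^5: for |q|<1 and r ∈ {0,1,2,3,4,5}, with χ_{2r}^{(5,12)}(z;q) as in the Weyl–Kac theta-quotient form, one has χ_{2r}^{(5,12)}(iq^5;q) = -(-1)^{κ(r)} i q^{10-5r} q^{-1/8 + 5(2r+1)^2/48} j(-q^{10r+5}; q^{120}) · J_2/(J_1 J_4), where κ(r)=0 for r∈{0,1,4,5} and κ(r)=1 for r∈{2,3}. -/

import Mathlib

open Complex

/-- Infinite q-Pochhammer symbol `(x;q)_∞ = ∏_{i≥0} (1 - q^i x)`. -/
noncomputable def qPoch (x q : ℂ) : ℂ := ∏' i : ℕ, (1 - q ^ i * x)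

/-- Theta function `j(x;q) = (x;q)_∞ (q/x;q)_∞ (q;q)_∞`. -/
noncomputable def jtheta (x q : ℂ) : ℂ := qPoch x q * qPoch (q / x) q * qPoch q q

/-- Fractional power of `q = e^{2πiτ}`: `q^α := e^{2πiατ}`. -/
noncomputable def qpow (τ α : ℂ) : ℂ := Complex.exp (2 * Real.pi * Complex.I * α * τ)

/-- The sign exponent κ: `κ(r) = 1` if `r ∈ {2,3}`, and `κ(r) = 0` otherwise. -/
def kappa (r : ℕ) : ℕ := if r = 2 ∨ r = 3 then 1 else 0

/-- The admissible character `χ_{2r}^{(5,12)}(z;q)` in Weyl–Kac theta-quotient form,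
with `q = e^{2πiτ}`. -/
noncomputable def chi512 (τ : ℂ) (r : ℕ) (z : ℂ) : ℂ :=
  let q : ℂ := qpow τ 1
  z ^ (-(r : ℤ)) * qpow τ (-(1 / 8) + 5 * (2 * r + 1) ^ 2 / 48)
    * (jtheta (-q ^ (5 * (2 * (r : ℤ) + 1) + 60) * z ^ (-12 : ℤ)) (q ^ 120)
        - z ^ (2 * r + 1)
            * jtheta (-q ^ (-5 * (2 * (r : ℤ) + 1) + 60) * z ^ (-12 : ℤ)) (q ^ 120))
    / jtheta z q

theorem multipliable_one_sub_pow_mul (x : ℂ) {q : ℂ} (hq : ‖q‖ < 1) :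
    Multipliable fun i : ℕ => 1 - q ^ i * x := by
  simp_rw [sub_eq_add_neg]
  refine multipliable_one_add_of_summable ?_
  simpa using (summable_geometric_of_lt_one (norm_nonneg _) hq).mul_right ‖x‖

theorem qPoch_eq_one_sub_mul (x : ℂ) {q : ℂ} (hq : ‖q‖ < 1) :
    qPoch x q = (1 - x) * qPoch (q * x) q := by
  have h (i : ℕ) : 1 - q ^ (i + 1) * x = 1 - q ^ i * (q * x) := by ring
  unfold qPoch
  rw [tprod_eq_zero_mul' (by simpa only [h] using multipliable_one_sub_pow_mul (q * x) hq)]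
  simp only [h, pow_zero, one_mul]

theorem qPoch_mul_qPoch_neg (x : ℂ) {q : ℂ} (hq : ‖q‖ < 1) :
    qPoch x q * qPoch (-x) q = qPoch (x ^ 2) (q ^ 2) := by
  unfold qPoch
  rw [← (multipliable_one_sub_pow_mul x hq).tprod_mul (multipliable_one_sub_pow_mul (-x) hq)]
  exact tprod_congr fun i => by ring

theorem qPoch_self_ne_zero {q : ℂ} (hq : ‖q‖ < 1) : qPoch q q ≠ 0 := by
  unfold qPoch
  simp_rw [sub_eq_add_neg]
  refine tprod_one_add_ne_zero_of_summable (fun i h => ?_) ?_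
  · have h1 : q ^ (i + 1) = 1 := by linear_combination -h
    have h2 : ‖q‖ ^ (i + 1) = 1 := by rw [← norm_pow, h1, norm_one]
    exact (pow_lt_one₀ (norm_nonneg q) hq i.succ_ne_zero).ne h2
  · simpa using (summable_geometric_of_lt_one (norm_nonneg _) hq).mul_right ‖q‖

theorem jtheta_mul_left {x q : ℂ} (hx : x ≠ 0) (hq0 : q ≠ 0) (hq : ‖q‖ < 1) :
    jtheta (q * x) q = -x⁻¹ * jtheta x q := by
  have h : q / (q * x) = x⁻¹ := by field_simp
  rw [jtheta, jtheta, h, qPoch_eq_one_sub_mul x hq, qPoch_eq_one_sub_mul x⁻¹ hq, ← div_eq_mul_inv]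
  field_simp
  ring

theorem jtheta_inv {x q : ℂ} (hx : x ≠ 0) (hq0 : q ≠ 0) (hq : ‖q‖ < 1) :
    jtheta x⁻¹ q = -x⁻¹ * jtheta x q := by
  rw [← jtheta_mul_left hx hq0 hq, jtheta, jtheta, div_inv_eq_mul, div_mul_cancel_left₀ hq0,
    mul_comm (qPoch x⁻¹ q)]

theorem jtheta_I_mul_pow_five {q : ℂ} (hq0 : q ≠ 0) (hq : ‖q‖ < 1) :
    q ^ 10 * jtheta (I * q ^ 5) q = I * jtheta I q := by
  have h (n : ℕ) : jtheta (q ^ (n + 1) * I) q = -(q ^ n * I)⁻¹ * jtheta (q ^ n * I) q := by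
    rw [pow_succ', mul_assoc,
      jtheta_mul_left (mul_ne_zero (pow_ne_zero n hq0) I_ne_zero) hq0 hq]
  rw [mul_comm I, h 4, h 3, h 2, h 1, h 0, pow_zero, one_mul]
  have hI := I_ne_zero
  field_simp
  linear_combination (-1 + I ^ 2 - I ^ 4) * jtheta I q * I_sq

theorem jtheta_I {q : ℂ} (hq : ‖q‖ < 1) :
    jtheta I q * qPoch (q ^ 2) (q ^ 2) = (1 - I) * qPoch q q * qPoch (q ^ 4) (q ^ 4) := by
  have hq2 : ‖q ^ 2‖ < 1 := by
    rw [norm_pow]; exact pow_lt_one₀ (norm_nonneg q) hq two_ne_zero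
  have h1 := qPoch_mul_qPoch_neg (q * I) hq
  have h2 := qPoch_mul_qPoch_neg (q ^ 2) hq2
  rw [mul_pow, I_sq, mul_neg_one] at h1
  rw [← pow_mul] at h2
  have h3 : q / I = -(q * I) := by rw [div_I]
  rw [jtheta, qPoch_eq_one_sub_mul I hq, h3]
  linear_combination (1 - I) * qPoch q q * (qPoch (q ^ 2) (q ^ 2) * h1 + h2)

theorem norm_qpow_one_lt_one {τ : ℂ} (hτ : 0 < τ.im) : ‖qpow τ 1‖ < 1 := by
  simpa [qpow] using UpperHalfPlane.norm_exp_two_pi_I_lt_one ⟨τ, hτ⟩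

theorem chi512_eval_at_iq5 (τ : ℂ) (hτ : 0 < τ.im) (r : ℕ) (hr : r ≤ 5) :
    chi512 τ r (Complex.I * (qpow τ 1) ^ 5)
      = -((-1 : ℂ) ^ kappa r) * Complex.I * (qpow τ 1) ^ (10 - 5 * (r : ℤ))
          * qpow τ (-(1 / 8) + 5 * (2 * r + 1) ^ 2 / 48)
          * jtheta (-(qpow τ 1) ^ (10 * r + 5)) ((qpow τ 1) ^ 120)
          * (qPoch ((qpow τ 1) ^ 2) ((qpow τ 1) ^ 2)
              / (qPoch (qpow τ 1) (qpow τ 1)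
                  * qPoch ((qpow τ 1) ^ 4) ((qpow τ 1) ^ 4))) := by
  unfold chi512
  have hq : ‖qpow τ 1‖ < 1 := norm_qpow_one_lt_one hτ
  have hq0 : qpow τ 1 ≠ 0 := Complex.exp_ne_zero _
  generalize qpow τ (-(1 / 8) + 5 * (2 * r + 1) ^ 2 / 48) = c
  generalize qpow τ 1 = q at hq hq0 ⊢
  have hpow {n : ℕ} (hn : n ≠ 0) : ‖q ^ n‖ < 1 := by
    rw [norm_pow]; exact pow_lt_one₀ (norm_nonneg q) hq hn
  have hI12 : I ^ 12 = 1 := by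
    rw [show (12 : ℕ) = 4 * 3 from rfl, pow_mul, I_pow_four, one_pow]
  have hz : (I * q ^ 5) ^ (-12 : ℤ) = q ^ (-60 : ℤ) := by
    rw [zpow_neg, zpow_neg]
    norm_cast
    rw [mul_pow, hI12, one_mul, ← pow_mul]
  have h1 : -q ^ (5 * (2 * (r : ℤ) + 1) + 60) * (I * q ^ 5) ^ (-12 : ℤ)
      = -q ^ (10 * r + 5) := by
    rw [hz, neg_mul, ← zpow_add₀ hq0, ← zpow_natCast]
    congr 2
    push_cast
    ring
  have h2 : -q ^ (-5 * (2 * (r : ℤ) + 1) + 60) * (I * q ^ 5) ^ (-12 : ℤ)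
      = (-q ^ (10 * r + 5))⁻¹ := by
    rw [hz, neg_mul, ← zpow_add₀ hq0, ← zpow_natCast, inv_neg, ← zpow_neg]
    congr 2
    push_cast
    ring
  have h3 := jtheta_inv (neg_ne_zero.mpr (pow_ne_zero (10 * r + 5) hq0)) (pow_ne_zero 120 hq0)
    (hpow (by norm_num))
  have hJ1 := qPoch_self_ne_zero hq
  have hJ2 := qPoch_self_ne_zero (hpow two_ne_zero)
  have hJ4 := qPoch_self_ne_zero (hpow four_ne_zero)
  have hI1 : 1 - I ≠ 0 := fun h => by simpa using congrArg Complex.im h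
  have hden : jtheta (I * q ^ 5) q
      = I * (1 - I) * qPoch q q * qPoch (q ^ 4) (q ^ 4) / (q ^ 10 * qPoch (q ^ 2) (q ^ 2)) := by
    rw [eq_div_iff (mul_ne_zero (pow_ne_zero 10 hq0) hJ2)]
    linear_combination qPoch (q ^ 2) (q ^ 2) * jtheta_I_mul_pow_five hq0 hq + I * jtheta_I hq
  have hcoef : 1 - I ^ (2 * r + 1) = -(-1) ^ kappa r * I * (I ^ r * (I * (1 - I))) := by
    interval_cases r <;> simp [kappa, pow_succ, mul_sub, ← mul_assoc] <;>
      first | ring1 | linear_combination I_sq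
  have hzr : (q : ℂ) ^ (10 - 5 * (r : ℤ)) = q ^ 10 / q ^ (5 * r) := by
    rw [zpow_sub₀ hq0]
    norm_cast
  have hbr : (I * q ^ 5) ^ (2 * r + 1) * (-q ^ (10 * r + 5))⁻¹ = -I ^ (2 * r + 1) := by
    have hp := pow_ne_zero (10 * r + 5) hq0
    rw [mul_pow, ← pow_mul, show 5 * (2 * r + 1) = 10 * r + 5 by ring]
    field_simp
  dsimp only
  rw [h1, h2, h3, hden, hzr, zpow_neg, zpow_natCast, mul_pow, ← pow_mul]
  generalize jtheta (-q ^ (10 * r + 5)) (q ^ 120) = A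
  have hnum : A - (I * q ^ 5) ^ (2 * r + 1) * (-(-q ^ (10 * r + 5))⁻¹ * A)
      = -(-1) ^ kappa r * I * (I ^ r * (I * (1 - I))) * A := by
    linear_combination A * hbr + A * hcoef
  rw [hnum]
  have hI := I_ne_zero
  field_simp
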